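/- ProxSkip converges linearly: under L-smoothness and μ-strong convexity of f, proper closed convexity of ψ, with 0 < γ ≤ 1/L and 0 < p ≤ 1, the Lyapunov function Ψ_t = ‖x_t - x⋆‖² + (γ²/p²)‖h_t - h⋆‖² satisfies E[Ψ_T] ≤ (1 - ζ)^T Ψ_0, where ζ = min{γμ, p²}. -/

import Mathlib

open RealInnerProductSpace
noncomputable section
abbrev Euc (d : ℕ) := EuclideanSpace ℝ (Fin d)

/-- `ψ` is proper, closed (lower semicontinuous) and convex, with values in `ℝ ∪ {+∞}`. -/
def ProperClosedConvex {d : ℕ} (ψ : Euc d → EReal) : Prop :=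
  (∃ x, ψ x ≠ ⊤) ∧ (∀ x, ψ x ≠ ⊥) ∧ LowerSemicontinuous ψ ∧
    ∀ x y : Euc d, ∀ a b : ℝ, 0 ≤ a → 0 ≤ b → a + b = 1 →
      ψ (a • x + b • y) ≤ (a : EReal) * ψ x + (b : EReal) * ψ y

/-- `q = prox_{αψ}(x)`, i.e. `q` minimizes `y ↦ ½‖y - x‖² + α ψ(y)`. -/
def IsProxPt {d : ℕ} (ψ : Euc d → EReal) (α : ℝ) (x q : Euc d) : Prop :=
  ∀ y : Euc d, (((1:ℝ)/2 * ‖q - x‖^2 : ℝ) : EReal) + (α : EReal) * ψ q ≤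
    (((1:ℝ)/2 * ‖y - x‖^2 : ℝ) : EReal) + (α : EReal) * ψ y

/-- One step of ProxSkip: given the coin flip `θ`, update the state `(x, h)`. -/
def proxSkipStep {d : ℕ} (f' : Euc d → Euc d) (prox : Euc d → Euc d) (γ p : ℝ)
    (θ : Bool) (s : Euc d × Euc d) : Euc d × Euc d :=
  let xhat := s.1 - γ • (f' s.1 - s.2)
  if θ then
    let xn := prox (xhat - (γ / p) • s.2)
    (xn, s.2 + (p / γ) • (xn - xhat))
  else (xhat, s.2)

/-- The ProxSkip trajectory driven by the coin flips `θ`. -/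
def proxSkipTraj {d : ℕ} (f' : Euc d → Euc d) (prox : Euc d → Euc d) (γ p : ℝ)
    (x0 h0 : Euc d) (θ : ℕ → Bool) : ℕ → Euc d × Euc d
  | 0 => (x0, h0)
  | t + 1 => proxSkipStep f' prox γ p (θ t) (proxSkipTraj f' prox γ p x0 h0 θ t)

lemma le_of_hasDerivAt_of_mul_le_sub {k : ℝ → ℝ} {c D : ℝ} (hk : HasDerivAt k D 0)
    (h : ∀ t : ℝ, 0 < t → t ≤ 1 → t * c ≤ k t - k 0) : c ≤ D := by
  have hs := hk.tendsto_slope_zero_right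
  refine ge_of_tendsto hs ?_
  filter_upwards [Ioc_mem_nhdsGT (zero_lt_one' ℝ)] with t ht
  have := h t ht.1 ht.2
  rw [zero_add, smul_eq_mul, inv_mul_eq_div, le_div_iff₀ ht.1]
  linarith

lemma hasDerivAt_norm_add_smul_sq {E : Type*} [NormedAddCommGroup E]
    [InnerProductSpace ℝ E] (x w : E) (t : ℝ) :
    HasDerivAt (fun s : ℝ => ‖x + s • w‖ ^ 2) (2 * inner ℝ (x + t • w) w) t := by
  have hl : HasDerivAt (fun s : ℝ => x + s • w) w t := by
    simpa using ((hasDerivAt_id t).smul_const w).const_add x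
  exact hl.norm_sq

section Gradient

variable {E : Type*} [NormedAddCommGroup E] [InnerProductSpace ℝ E] [CompleteSpace E]

lemma HasGradientAt.hasDerivAt_add_smul {f : E → ℝ} {v x w : E} {t : ℝ}
    (h : HasGradientAt f v (x + t • w)) :
    HasDerivAt (fun s : ℝ => f (x + s • w)) (inner ℝ v w) t := by
  have hl : HasDerivAt (fun s : ℝ => x + s • w) w t := by
    simpa using ((hasDerivAt_id t).smul_const w).const_add x
  exact (h.hasFDerivAt.comp_hasDerivAt t hl).congr_deriv (by simp)

/-- First-order lower bound for a differentiable strongly convex function. -/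
lemma add_inner_add_le_of_strongly_convex {f : E → ℝ} {f' : E → E} {μ : ℝ}
    (hgrad : ∀ x, HasGradientAt f (f' x) x)
    (hsc : ConvexOn ℝ Set.univ fun x => f x - μ / 2 * ‖x‖ ^ 2) (x y : E) :
    f x + inner ℝ (f' x) (y - x) + μ / 2 * ‖y - x‖ ^ 2 ≤ f y := by
  have hd : HasDerivAt (fun t : ℝ => f (x + t • (y - x)) - μ / 2 * ‖x + t • (y - x)‖ ^ 2)
      (inner ℝ (f' x) (y - x) - μ / 2 * (2 * inner ℝ x (y - x))) 0 := by
    have h1 := HasGradientAt.hasDerivAt_add_smul (f := f) (v := f' x) (x := x) (w := y - x)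
      (t := 0) (by simpa using hgrad x)
    exact (h1.sub ((hasDerivAt_norm_add_smul_sq x (y - x) 0).const_mul (μ / 2))).congr_deriv
      (by simp)
  have key := le_of_hasDerivAt_of_mul_le_sub hd.neg
    (c := (f x - μ / 2 * ‖x‖ ^ 2) - (f y - μ / 2 * ‖y‖ ^ 2)) (by
      intro t ht ht1
      have hc := hsc.2 (Set.mem_univ x) (Set.mem_univ y) (sub_nonneg.2 ht1) ht.le
        (sub_add_cancel 1 t)
      have he : (1 - t) • x + t • y = x + t • (y - x) := by module
      simp only [he, smul_eq_mul] at hc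
      simp only [Pi.neg_apply, zero_smul, add_zero]
      linarith)
  have h2 : ‖y - x‖ ^ 2 = ‖y‖ ^ 2 - ‖x‖ ^ 2 - 2 * inner ℝ x (y - x) := by
    rw [norm_sub_sq_real, inner_sub_right, real_inner_self_eq_norm_sq, real_inner_comm]
    ring
  rw [h2]
  linarith

/-- The descent lemma: quadratic upper bound for a function with Lipschitz gradient. -/
lemma le_add_inner_add_of_lipschitz_gradient {f : E → ℝ} {f' : E → E} {L : ℝ}
    (hgrad : ∀ x, HasGradientAt f (f' x) x)
    (hsmooth : ∀ x y, ‖f' x - f' y‖ ≤ L * ‖x - y‖) (x w : E) :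
    f (x + w) ≤ f x + inner ℝ (f' x) w + L / 2 * ‖w‖ ^ 2 := by
  have hk (t : ℝ) : HasDerivAt (fun s : ℝ => f (x + s • w)) (inner ℝ (f' (x + t • w)) w) t :=
    (hgrad _).hasDerivAt_add_smul
  have hB (t : ℝ) : HasDerivAt
      (fun s : ℝ => f x + s * inner ℝ (f' x) w + L / 2 * ‖w‖ ^ 2 * s ^ 2)
      (inner ℝ (f' x) w + L * ‖w‖ ^ 2 * t) t := by
    have h1 := ((hasDerivAt_id t).mul_const (inner ℝ (f' x) w)).const_add (f x)
    have h2 := ((hasDerivAt_id t).pow 2).const_mul (L / 2 * ‖w‖ ^ 2)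
    refine (h1.add h2).congr_deriv ?_
    simp only [id]
    ring
  have := image_le_of_deriv_right_le_deriv_boundary (a := 0) (b := 1)
    (fun t _ => (hk t).continuousAt.continuousWithinAt)
    (fun t _ => (hk t).hasDerivWithinAt) (by simp)
    (fun t _ => (hB t).continuousAt.continuousWithinAt)
    (fun t _ => (hB t).hasDerivWithinAt) (by
      intro t ht
      have h1 := real_inner_le_norm (f' (x + t • w) - f' x) w
      have h2 := hsmooth (x + t • w) x
      rw [add_sub_cancel_left, norm_smul, Real.norm_of_nonneg ht.1] at h2
      rw [inner_sub_left] at h1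
      nlinarith [mul_le_mul_of_nonneg_right h2 (norm_nonneg w)])
    (Set.right_mem_Icc.2 zero_le_one)
  simpa using this

/-- Cocoercivity of the gradient of a smooth convex function (Baillon–Haddad). -/
lemma norm_sub_sq_le_mul_inner_of_smooth {f : E → ℝ} {f' : E → E} {L : ℝ} (hL : 0 < L)
    (hgrad : ∀ x, HasGradientAt f (f' x) x)
    (hsmooth : ∀ x y, ‖f' x - f' y‖ ≤ L * ‖x - y‖)
    (hconv : ∀ x y, f x + inner ℝ (f' x) (y - x) ≤ f y) (x y : E) :
    ‖f' x - f' y‖ ^ 2 ≤ L * inner ℝ (f' x - f' y) (x - y) := by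
  have half (x y : E) : ‖f' x - f' y‖ ^ 2 ≤ 2 * L * (f x - f y - inner ℝ (f' y) (x - y)) := by
    have h1 := le_add_inner_add_of_lipschitz_gradient hgrad hsmooth x (-(L⁻¹ • (f' x - f' y)))
    have h2 := hconv y (x + -(L⁻¹ • (f' x - f' y)))
    have e : x + -(L⁻¹ • (f' x - f' y)) - y = (x - y) - L⁻¹ • (f' x - f' y) := by module
    have e2 : ‖f' x - f' y‖ ^ 2 = inner ℝ (f' x) (f' x - f' y) - inner ℝ (f' y) (f' x - f' y) := by
      rw [← inner_sub_left, real_inner_self_eq_norm_sq]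
    rw [e, inner_sub_right, inner_smul_right] at h2
    rw [inner_neg_right, inner_smul_right, norm_neg, norm_smul, mul_pow, Real.norm_eq_abs,
      sq_abs] at h1
    have h3 : 0 ≤ f x - f y - inner ℝ (f' y) (x - y) - L⁻¹ / 2 * ‖f' x - f' y‖ ^ 2 := by
      have e3 : L / 2 * (L⁻¹ ^ 2 * ‖f' x - f' y‖ ^ 2) = L⁻¹ / 2 * ‖f' x - f' y‖ ^ 2 := by
        field_simp
      rw [e3] at h1
      have e4 := congrArg (L⁻¹ * ·) e2
      simp only [mul_sub] at e4
      linarith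
    have h4 := mul_nonneg (by positivity : 0 ≤ 2 * L) h3
    have e5 : 2 * L * (L⁻¹ / 2 * ‖f' x - f' y‖ ^ 2) = ‖f' x - f' y‖ ^ 2 := by
      field_simp
    rw [mul_sub, e5] at h4
    linarith
  have h1 := half x y
  have h2 := half y x
  rw [norm_sub_rev, ← neg_sub x y, inner_neg_right] at h2
  rw [inner_sub_left]
  linarith

/-- The gradient step is a contraction with squared factor `1 - γμ`. -/
lemma norm_gradient_step_sub_sq_le {f : E → ℝ} {f' : E → E} {L μ γ : ℝ} (hL : 0 < L)
    (hμ : 0 < μ) (hgrad : ∀ x, HasGradientAt f (f' x) x)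
    (hsmooth : ∀ x y, ‖f' x - f' y‖ ≤ L * ‖x - y‖)
    (hsc : ConvexOn ℝ Set.univ fun x => f x - μ / 2 * ‖x‖ ^ 2)
    (hγ : 0 < γ) (hγL : γ ≤ 1 / L) (x y : E) :
    ‖(x - y) - γ • (f' x - f' y)‖ ^ 2 ≤ (1 - γ * μ) * ‖x - y‖ ^ 2 := by
  have hlow := add_inner_add_le_of_strongly_convex hgrad hsc
  have hco := norm_sub_sq_le_mul_inner_of_smooth hL hgrad hsmooth
    (fun x y => by nlinarith [hlow x y, sq_nonneg ‖y - x‖]) x y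
  have hmono : μ * ‖x - y‖ ^ 2 ≤ inner ℝ (f' x - f' y) (x - y) := by
    have h1 := hlow x y
    have h2 := hlow y x
    rw [norm_sub_rev, ← neg_sub x y, inner_neg_right] at h1
    rw [inner_sub_left]
    linarith
  have hγL' : γ * L ≤ 1 := (le_div_iff₀ hL).1 hγL
  have hI : 0 ≤ inner ℝ (f' x - f' y) (x - y) := le_trans (by positivity) hmono
  have hco' : γ * ‖f' x - f' y‖ ^ 2 ≤ inner ℝ (f' x - f' y) (x - y) := by
    nlinarith [mul_le_mul_of_nonneg_left hco hγ.le, mul_le_mul_of_nonneg_right hγL' hI]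
  rw [norm_sub_sq_real, inner_smul_right, real_inner_comm, norm_smul, mul_pow, Real.norm_eq_abs,
    sq_abs]
  nlinarith [mul_le_mul_of_nonneg_left hco' hγ.le, mul_le_mul_of_nonneg_left hmono hγ.le]

end Gradient

section Prox

variable {d : ℕ} {ψ : Euc d → EReal}

lemma ProperClosedConvex.ne_top_of_forall_add_le (hψ : ProperClosedConvex ψ) {g : Euc d → ℝ}
    {α : ℝ} (hα : 0 < α) {q : Euc d}
    (hq : ∀ y, ((g q : ℝ) : EReal) + (α : EReal) * ψ q ≤ ((g y : ℝ) : EReal) + (α : EReal) * ψ y) :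
    ψ q ≠ ⊤ := by
  intro htop
  obtain ⟨z, hz⟩ := hψ.1
  have h := hq z
  have hz' := EReal.coe_toReal hz (hψ.2.1 z)
  rw [htop, EReal.coe_mul_top_of_pos hα, EReal.coe_add_top, ← hz', ← EReal.coe_mul,
    ← EReal.coe_add] at h
  exact EReal.coe_ne_top _ (top_le_iff.1 h)

/-- First-order optimality condition for minimizing `g + αψ` with `g` differentiable. -/
lemma ProperClosedConvex.mul_sub_le_inner (hψ : ProperClosedConvex ψ) {g : Euc d → ℝ}
    {α : ℝ} (hα : 0 < α) {q v y : Euc d}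
    (hv : HasDerivAt (fun t : ℝ => g (q + t • (y - q))) (inner ℝ v (y - q)) 0)
    (hq : ∀ y, ((g q : ℝ) : EReal) + (α : EReal) * ψ q ≤ ((g y : ℝ) : EReal) + (α : EReal) * ψ y)
    (hy : ψ y ≠ ⊤) :
    α * ((ψ q).toReal - (ψ y).toReal) ≤ inner ℝ v (y - q) := by
  refine le_of_hasDerivAt_of_mul_le_sub hv fun t ht ht1 => ?_
  have hqr := EReal.coe_toReal (hψ.ne_top_of_forall_add_le hα hq) (hψ.2.1 q)
  have hyr := EReal.coe_toReal hy (hψ.2.1 y)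
  have hc := hψ.2.2.2 q y (1 - t) t (sub_nonneg.2 ht1) ht.le (sub_add_cancel 1 t)
  have h1 := hq (q + t • (y - q))
  have he : (1 - t) • q + t • y = q + t • (y - q) := by module
  rw [he, ← hqr, ← hyr, ← EReal.coe_mul, ← EReal.coe_mul, ← EReal.coe_add] at hc
  have hzr := EReal.coe_toReal (ne_top_of_le_ne_top (EReal.coe_ne_top _) hc) (hψ.2.1 _)
  rw [← hzr] at hc h1
  rw [← hqr, ← EReal.coe_mul, ← EReal.coe_mul, ← EReal.coe_add, ← EReal.coe_add] at h1
  have hc' := EReal.coe_le_coe_iff.1 hc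
  have h1' := EReal.coe_le_coe_iff.1 h1
  have := mul_le_mul_of_nonneg_left hc' hα.le
  simp only [zero_smul, add_zero]
  linarith

/-- Monotonicity of `∂ψ` between a proximal point and a minimizer of `f + ψ`. -/
lemma IsProxPt.inner_sub_nonneg (hψ : ProperClosedConvex ψ) {f : Euc d → ℝ} {hstar : Euc d}
    {xstar u q : Euc d} {α : ℝ} (hα : 0 < α) (hgrad : HasGradientAt f hstar xstar)
    (hmin : ∀ y, ((f xstar : ℝ) : EReal) + ψ xstar ≤ ((f y : ℝ) : EReal) + ψ y)
    (hq : IsProxPt ψ α u q) : 0 ≤ inner ℝ (q - xstar) (u - q + α • hstar) := by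
  have hmin' (y : Euc d) : ((f xstar : ℝ) : EReal) + ((1 : ℝ) : EReal) * ψ xstar ≤
      ((f y : ℝ) : EReal) + ((1 : ℝ) : EReal) * ψ y := by
    simpa using hmin y
  have htx := hψ.ne_top_of_forall_add_le one_pos hmin'
  have htq := hψ.ne_top_of_forall_add_le (g := fun y => (1 : ℝ) / 2 * ‖y - u‖ ^ 2) hα hq
  have h1 := hψ.mul_sub_le_inner one_pos (v := hstar) (y := q)
    (HasGradientAt.hasDerivAt_add_smul (by simpa using hgrad)) hmin' htq
  have hd : HasDerivAt (fun t : ℝ => (1 : ℝ) / 2 * ‖q + t • (xstar - q) - u‖ ^ 2)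
      (inner ℝ (q - u) (xstar - q)) 0 := by
    have := (hasDerivAt_norm_add_smul_sq (q - u) (xstar - q) 0).const_mul ((1 : ℝ) / 2)
    simp only [← add_sub_right_comm] at this
    exact this.congr_deriv (by simp)
  have h2 := hψ.mul_sub_le_inner (g := fun y => (1 : ℝ) / 2 * ‖y - u‖ ^ 2) hα hd hq htx
  have h3 := mul_le_mul_of_nonneg_left h1 hα.le
  rw [← neg_sub q xstar, inner_neg_right, ← inner_neg_left, neg_sub] at h2
  rw [inner_add_right, inner_smul_right, real_inner_comm, real_inner_comm hstar]
  linarith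

end Prox

/-- The Lyapunov function `Ψ`, written as a function of the state. -/
def proxSkipLyapunov {d : ℕ} (xstar hstar : Euc d) (γ p : ℝ) (s : Euc d × Euc d) : ℝ :=
  ‖s.1 - xstar‖ ^ 2 + γ ^ 2 / p ^ 2 * ‖s.2 - hstar‖ ^ 2

lemma proxSkipLyapunov_step_le {d : ℕ} {f : Euc d → ℝ} {f' : Euc d → Euc d}
    {ψ : Euc d → EReal} {L μ γ p : ℝ} (hL : 0 < L) (hμ : 0 < μ)
    (hgrad : ∀ x, HasGradientAt f (f' x) x)
    (hsmooth : ∀ x y, ‖f' x - f' y‖ ≤ L * ‖x - y‖)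
    (hsc : ConvexOn ℝ Set.univ fun x => f x - μ / 2 * ‖x‖ ^ 2)
    (hψ : ProperClosedConvex ψ)
    (hγ : 0 < γ) (hγL : γ ≤ 1 / L) (hp : 0 < p)
    {xstar : Euc d}
    (hmin : ∀ y, ((f xstar : ℝ) : EReal) + ψ xstar ≤ ((f y : ℝ) : EReal) + ψ y)
    {prox : Euc d → Euc d} (hprox : ∀ u, IsProxPt ψ (γ / p) u (prox u)) (s : Euc d × Euc d) :
    p * proxSkipLyapunov xstar (f' xstar) γ p (proxSkipStep f' prox γ p true s) +
        (1 - p) * proxSkipLyapunov xstar (f' xstar) γ p (proxSkipStep f' prox γ p false s) ≤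
      (1 - min (γ * μ) (p ^ 2)) * proxSkipLyapunov xstar (f' xstar) γ p s := by
  obtain ⟨x, h⟩ := s
  simp only [proxSkipLyapunov, proxSkipStep, if_true, Bool.false_eq_true, if_false]
  set xhat := x - γ • (f' x - h) with hxhat
  set q := prox (xhat - (γ / p) • h) with hq
  set α := γ / p with hα
  have hα0 : 0 < α := div_pos hγ hp
  have hmon := (hprox (xhat - α • h)).inner_sub_nonneg hψ hα0 (hgrad xstar) hmin
  rw [← hq] at hmon
  have scale (v : Euc d) : γ ^ 2 / p ^ 2 * ‖v‖ ^ 2 = ‖α • v‖ ^ 2 := by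
    rw [norm_smul, mul_pow, Real.norm_eq_abs, sq_abs, hα, div_pow]
  set A := q - xstar with hA
  set B := xhat - xstar with hB
  set H := α • (h - f' xstar) with hH
  have e1 : α • (h + (p / γ) • (q - xhat) - f' xstar) = A - (B - H) := by
    have : α * (p / γ) = 1 := by rw [hα]; field_simp
    rw [add_sub_right_comm, smul_add, smul_smul, this, hA, hB, hH]
    module
  have e2 : xhat - α • h - q + α • f' xstar = (B - H) - A := by
    rw [hA, hB, hH]; module
  have e3 : (x - xstar) - γ • (f' x - f' xstar) = B - p • H := by
    have : p * α = γ := by rw [hα]; field_simp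
    rw [hB, hH, smul_smul, this, hxhat]; module
  have hstep := norm_gradient_step_sub_sq_le hL hμ hgrad hsmooth hsc hγ hγL x xstar
  rw [e3, norm_sub_sq_real, inner_smul_right, norm_smul, mul_pow, Real.norm_eq_abs, sq_abs] at hstep
  rw [e2, inner_sub_right, real_inner_self_eq_norm_sq] at hmon
  have hBH := norm_sub_sq_real B H
  have hABH := norm_sub_sq_real A (B - H)
  have hcomm : p * (‖A‖ ^ 2 + ‖A - (B - H)‖ ^ 2) ≤
      p * (‖B‖ ^ 2 - 2 * inner ℝ B H + ‖H‖ ^ 2) :=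
    mul_le_mul_of_nonneg_left (by linarith) hp.le
  rw [scale, scale, ← hH, e1]
  have m1 := mul_le_mul_of_nonneg_right (min_le_left (γ * μ) (p ^ 2)) (sq_nonneg ‖x - xstar‖)
  have m2 := mul_le_mul_of_nonneg_right (min_le_right (γ * μ) (p ^ 2)) (sq_nonneg ‖H‖)
  linarith

lemma proxSkipTraj_succ_eq {d : ℕ} (f' prox : Euc d → Euc d) (γ p : ℝ) (s : Euc d × Euc d)
    (θ : ℕ → Bool) (t : ℕ) :
    proxSkipTraj f' prox γ p s.1 s.2 θ (t + 1) =
      proxSkipTraj f' prox γ p (proxSkipStep f' prox γ p (θ 0) s).1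
        (proxSkipStep f' prox γ p (θ 0) s).2 (fun n => θ (n + 1)) t := by
  induction t with
  | zero => rfl
  | succ t ih => rw [proxSkipTraj, ih]; rfl

/-- A function contracting in expectation along one step contracts geometrically. -/
lemma sum_proxSkipTraj_le {d : ℕ} (f' prox : Euc d → Euc d) {γ p ρ : ℝ} (hp : 0 ≤ p)
    (hp1 : p ≤ 1) (hρ : 0 ≤ ρ) (V : Euc d × Euc d → ℝ)
    (hV : ∀ s, p * V (proxSkipStep f' prox γ p true s) +
      (1 - p) * V (proxSkipStep f' prox γ p false s) ≤ ρ * V s) (T : ℕ) (s : Euc d × Euc d) :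
    (∑ σ : Fin T → Bool, (∏ i : Fin T, if σ i then p else 1 - p) *
      V (proxSkipTraj f' prox γ p s.1 s.2 (fun t => if h : t < T then σ ⟨t, h⟩ else false) T))
    ≤ ρ ^ T * V s := by
  induction T generalizing s with
  | zero => simp [proxSkipTraj]
  | succ T ih =>
    rw [← (Fin.consEquiv fun _ : Fin (T + 1) => Bool).sum_comp, Fintype.sum_prod_type,
      Fintype.sum_bool]
    have split (b : Bool) : (∑ σ : Fin T → Bool,
        (∏ i : Fin (T + 1), if Fin.consEquiv (fun _ : Fin (T + 1) => Bool) (b, σ) i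
          then p else 1 - p) *
        V (proxSkipTraj f' prox γ p s.1 s.2 (fun t => if h : t < T + 1 then
          Fin.consEquiv (fun _ : Fin (T + 1) => Bool) (b, σ) ⟨t, h⟩ else false) (T + 1)))
        ≤ (if b then p else 1 - p) * (ρ ^ T * V (proxSkipStep f' prox γ p b s)) := by
      refine le_trans (le_of_eq ?_) (mul_le_mul_of_nonneg_left
        (ih (proxSkipStep f' prox γ p b s)) (by split_ifs <;> linarith))
      rw [Finset.mul_sum]
      refine Finset.sum_congr rfl fun σ _ => ?_
      have hshift : (fun n => if h : n + 1 < T + 1 then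
          (Fin.cons b σ : Fin (T + 1) → Bool) ⟨n + 1, h⟩ else false) =
          fun n => if h : n < T then σ ⟨n, h⟩ else false := by
        ext n
        by_cases hn : n < T
        · simp only [hn, add_lt_add_iff_right, dif_pos]
          rfl
        · simp [hn]
      rw [proxSkipTraj_succ_eq, Fin.prod_univ_succ, mul_assoc]
      simp only [Fin.consEquiv_apply, Fin.cons_zero, Fin.cons_succ, hshift, Nat.zero_lt_succ,
        dif_pos, Fin.zero_eta]
    refine (add_le_add (split true) (split false)).trans ?_
    have := mul_le_mul_of_nonneg_left (hV s) (pow_nonneg hρ T)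
    simp only [if_true, Bool.false_eq_true, if_false, pow_succ]
    linarith

/-- Main ProxSkip theorem: linear convergence of the Lyapunov function
`Ψ_t = ‖x_t - x⋆‖² + (γ²/p²)‖h_t - h⋆‖²` with rate `1 - min{γμ, p²}`.  The
expectation over the i.i.d. Bernoulli(p) coins `θ_0, …, θ_{T-1}` is written out
explicitly as a weighted sum over all coin sequences. -/
theorem proxskip_linear_convergence {d : ℕ} (f : Euc d → ℝ) (f' : Euc d → Euc d)
    (ψ : Euc d → EReal) (L μ γ p : ℝ) (hL : 0 < L) (hμ : 0 < μ)
    (hgrad : ∀ x, HasGradientAt f (f' x) x)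
    (hsmooth : ∀ x y, ‖f' x - f' y‖ ≤ L * ‖x - y‖)
    (hsc : ConvexOn ℝ Set.univ fun x => f x - μ / 2 * ‖x‖ ^ 2)
    (hψ : ProperClosedConvex ψ)
    (hγ : 0 < γ) (hγL : γ ≤ 1 / L) (hp : 0 < p) (hp1 : p ≤ 1)
    (xstar : Euc d)
    (hmin : ∀ y, ((f xstar : ℝ) : EReal) + ψ xstar ≤ ((f y : ℝ) : EReal) + ψ y)
    (prox : Euc d → Euc d) (hprox : ∀ u, IsProxPt ψ (γ / p) u (prox u))
    (x0 h0 : Euc d) (T : ℕ) :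
    (∑ σ : Fin T → Bool,
        (∏ i : Fin T, if σ i then p else 1 - p) *
          ((fun s : Euc d × Euc d =>
                ‖s.1 - xstar‖ ^ 2 + γ ^ 2 / p ^ 2 * ‖s.2 - f' xstar‖ ^ 2)
            (proxSkipTraj f' prox γ p x0 h0
              (fun t => if h : t < T then σ ⟨t, h⟩ else false) T)))
    ≤ (1 - min (γ * μ) (p ^ 2)) ^ T *
        (‖x0 - xstar‖ ^ 2 + γ ^ 2 / p ^ 2 * ‖h0 - f' xstar‖ ^ 2) := by
  have hρ : 0 ≤ 1 - min (γ * μ) (p ^ 2) :=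
    sub_nonneg.2 ((min_le_right _ _).trans (pow_le_one₀ hp.le hp1))
  exact sum_proxSkipTraj_le f' prox hp.le hp1 hρ (proxSkipLyapunov xstar (f' xstar) γ p)
    (proxSkipLyapunov_step_le hL hμ hgrad hsmooth hsc hψ hγ hγL hp hmin hprox) T (x0, h0)
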